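/- (Lemma 3.1(2)) For all indices i, j with 2 ≤ i, j ≤ k and i + j = k + 2, one has m_i = m_j, where m_i = ∏_{j ∈ S_{f_i}} w_j. -/

import Mathlib

open Finset

/-- The set `F = { l / w j : 0 ≤ l ≤ w j - 1, 0 ≤ j ≤ n }` of rational numbers. -/
def wpF (n : ℕ) (w : Fin (n + 1) → ℕ) : Finset ℚ :=
  (Finset.univ.sigma fun j : Fin (n + 1) => Finset.range (w j)).image
    fun p => (p.2 : ℚ) / (w p.1 : ℚ)

-- The set `S f = { j ∈ {0,…,n} : w j · f ∈ ℤ }`.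
open Classical in
noncomputable def wpS (n : ℕ) (w : Fin (n + 1) → ℕ) (x : ℚ) : Finset (Fin (n + 1)) :=
  Finset.univ.filter fun j => ∃ z : ℤ, (w j : ℚ) * x = (z : ℚ)

theorem one_sub_mem_wpF {n : ℕ} {w : Fin (n + 1) → ℕ} {x : ℚ} (hx : x ∈ wpF n w)
    (hpos : 0 < x) : 1 - x ∈ wpF n w := by
  simp only [wpF, Finset.mem_image, Finset.mem_sigma, Finset.mem_univ, true_and,
    Finset.mem_range] at hx ⊢
  obtain ⟨⟨j, l⟩, hl, rfl⟩ := hx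
  dsimp only at hl hpos ⊢
  have hl0 : 0 < l := by
    rcases Nat.eq_zero_or_pos l with rfl | h
    · simp at hpos
    · exact h
  have hw : (w j : ℚ) ≠ 0 := by
    have : w j ≠ 0 := by omega
    exact_mod_cast this
  refine ⟨⟨j, w j - l⟩, by dsimp only; omega, ?_⟩
  dsimp only
  rw [Nat.cast_sub hl.le]
  field_simp

theorem wpS_one_sub (n : ℕ) (w : Fin (n + 1) → ℕ) (x : ℚ) :
    wpS n w (1 - x) = wpS n w x := by
  ext j
  simp only [wpS, Finset.mem_filter, Finset.mem_univ, true_and]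
  constructor
  · rintro ⟨z, hz⟩
    exact ⟨w j - z, by push_cast; linarith⟩
  · rintro ⟨z, hz⟩
    exact ⟨w j - z, by push_cast; linarith⟩

/-- A strictly decreasing self-map of `{1, …, N}` is the reversal `i ↦ N + 1 - i`. -/
theorem add_eq_of_strictAnti_Icc {N : ℕ} {s : ℕ → ℕ}
    (hs : ∀ i, 1 ≤ i → i ≤ N → 1 ≤ s i ∧ s i ≤ N)
    (hanti : ∀ i j, 1 ≤ i → i < j → j ≤ N → s j < s i) {i : ℕ} (hi : 1 ≤ i) (hiN : i ≤ N) :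
    s i + i = N + 1 := by
  have upper : ∀ d, d + 1 ≤ N → s (d + 1) + d ≤ N := by
    intro d
    induction d with
    | zero => intro h; exact (hs 1 le_rfl h).2
    | succ d ih =>
      intro h
      have h₁ := ih (by omega)
      have h₂ := hanti (d + 1) (d + 1 + 1) (by omega) (by omega) h
      omega
  have lower : ∀ d i, 1 ≤ i → i + d = N → d + 1 ≤ s i := by
    intro d
    induction d with
    | zero => intro i h₁ h₂; have := (hs i h₁ (by omega)).1; omega
    | succ d ih =>
      intro i h₁ h₂
      have h₃ := ih (i + 1) (by omega) (by omega)
      have h₄ := hanti i (i + 1) h₁ (by omega) (by omega)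
      omega
  have h₁ := upper (i - 1) (by omega)
  have h₂ := lower (N - i) i hi (by omega)
  rw [Nat.sub_add_cancel hi] at h₁
  omega

theorem lemma_3_1_2 (n k : ℕ) (w : Fin (n + 1) → ℕ) (hw : ∀ j, 0 < w j)
    (f : ℕ → ℚ)
    (hmono : ∀ i j : ℕ, 1 ≤ i → i < j → j ≤ k + 1 → f i < f j)
    (hmem : ∀ i : ℕ, 1 ≤ i → i ≤ k → f i ∈ wpF n w)
    (hsurj : ∀ x ∈ wpF n w, ∃ i : ℕ, 1 ≤ i ∧ i ≤ k ∧ f i = x)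
    (hf1 : f 1 = 0) (hfk1 : f (k + 1) = 1) :
    ∀ i j : ℕ, 2 ≤ i → i ≤ k → 2 ≤ j → j ≤ k → i + j = k + 2 →
      ∏ l ∈ wpS n w (f i), w l = ∏ l ∈ wpS n w (f j), w l := by
  intro i j hi hik hj hjk hij
  have reflect : ∀ a : ℕ, ∃ b : ℕ, 1 ≤ a → a ≤ k + 1 → 1 ≤ b ∧ b ≤ k + 1 ∧ f b = 1 - f a := by
    intro a
    by_cases ha : 1 ≤ a ∧ a ≤ k + 1
    · obtain ⟨ha₁, hak⟩ := ha
      rcases ha₁.eq_or_lt with rfl | ha₁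
      · exact ⟨k + 1, fun _ _ => ⟨by omega, le_rfl, by rw [hf1, hfk1, sub_zero]⟩⟩
      rcases hak.eq_or_lt with rfl | hak
      · exact ⟨1, fun _ _ => ⟨le_rfl, by omega, by rw [hf1, hfk1, sub_self]⟩⟩
      have hpos : 0 < f a := hf1 ▸ hmono 1 a le_rfl ha₁ hak.le
      obtain ⟨b, hb₁, hbk, hb⟩ :=
        hsurj _ (one_sub_mem_wpF (hmem a ha₁.le (by omega)) hpos)
      exact ⟨b, fun _ _ => ⟨hb₁, by omega, hb⟩⟩
    · exact ⟨0, fun h₁ h₂ => absurd ⟨h₁, h₂⟩ ha⟩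
  choose s hs using reflect
  have hanti : ∀ a b, 1 ≤ a → a < b → b ≤ k + 1 → s b < s a := by
    intro a b ha hab hb
    obtain ⟨ha₁, ha₂, ha₃⟩ := hs a ha (by omega)
    obtain ⟨hb₁, hb₂, hb₃⟩ := hs b (by omega) hb
    have hlt := hmono a b ha hab hb
    by_contra! hle
    rcases hle.eq_or_lt with h | h
    · rw [h] at ha₃
      linarith
    · have := hmono _ _ ha₁ h hb₂
      linarith
  have hsi := add_eq_of_strictAnti_Icc (fun a h₁ h₂ => ⟨(hs a h₁ h₂).1, (hs a h₁ h₂).2.1⟩)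
    hanti (i := i) (by omega) (by omega)
  have hfj := (hs i (by omega) (by omega)).2.2
  rw [show s i = j by omega] at hfj
  rw [hfj, wpS_one_sub]
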